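/- The probability measure ν is not Gaussian: ν is not equal to the k-fold product of standard Gaussian measures N(0,1) on ℝ, and moreover ν is not a Gaussian measure on ℝ^k (i.e., it is not the case that the pushforward of ν under every continuous linear functional on ℝ^k is a one-dimensional Gaussian measure). -/

import Mathlib

open Real MeasureTheory ProbabilityTheory

/-- The density `ψ` of the measure `ν` on `ℝ^k`. -/
noncomputable def psi (k : ℕ) (x : Fin k → ℝ) : ℝ :=
  (2 * Real.pi) ^ (-(k : ℝ) / 2) *
    (1 + (∏ i, x i) * Real.exp (-(∑ i, x i ^ 2) / 2)) *
    Real.exp (-(∑ i, x i ^ 2) / 2)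

/-- The measure `ν` on `ℝ^k` with density `ψ` with respect to Lebesgue measure. -/
noncomputable def nu (k : ℕ) : Measure (Fin k → ℝ) :=
  (volume : Measure (Fin k → ℝ)).withDensity fun x => ENNReal.ofReal (psi k x)

/-- A measure on `ℝ^m` is Gaussian if its pushforward under every continuous
linear functional is a (possibly degenerate) one-dimensional Gaussian measure. -/
def IsGaussianMeasure {m : ℕ} (μ : Measure (Fin m → ℝ)) : Prop :=
  ∀ L : (Fin m → ℝ) →L[ℝ] ℝ, ∃ (a : ℝ) (v : NNReal), μ.map L = gaussianReal a v

open Complex in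
/-- The Fourier transform of `x ↦ x * exp (-x ^ 2)` (times the standard Gaussian normalization)
is a nonzero multiple of `s ↦ s * exp (-s ^ 2 / 4)`. -/
lemma exists_integral_gaussianPDFReal_mul_mul_exp_eq :
    ∃ C : ℂ, C ≠ 0 ∧ ∀ s : ℝ,
      ∫ x : ℝ, ((gaussianPDFReal 0 1 x * (x * Real.exp (-x ^ 2 / 2)) : ℝ) : ℂ) *
        cexp (s * x * I) = C * s * cexp (-s ^ 2 / 4) := by
  refine ⟨((√(2 * π))⁻¹ : ℝ) * (I / 2 * (π : ℂ) ^ (1 / 2 : ℂ)), ?_, fun s ↦ ?_⟩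
  · have h : (√(2 * π))⁻¹ ≠ 0 := by positivity
    have hpi : (π : ℂ) ≠ 0 := by exact_mod_cast Real.pi_ne_zero
    have := (Complex.cpow_ne_zero_iff_of_exponent_ne_zero (x := (π : ℂ))
      (y := (1 / 2 : ℂ)) (by norm_num)).2 hpi
    simp only [ne_eq, mul_eq_zero, ofReal_eq_zero, h, div_eq_zero_iff, I_ne_zero, this]
    norm_num
  have hexp : ∀ x : ℝ, ‖cexp (I * s * x)‖ ≤ 1 := fun x ↦ by simp [Complex.norm_exp]
  have hint₀ : Integrable fun x : ℝ ↦ cexp (I * s * x) * cexp (-1 * (x : ℂ) ^ 2) :=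
    (integrable_cexp_neg_mul_sq (b := 1) (by simp)).bdd_mul (by fun_prop) (.of_forall hexp)
  have hint₁ : Integrable fun x : ℝ ↦ cexp (I * s * x) * (x * cexp (-1 * (x : ℂ) ^ 2)) :=
    (integrable_mul_cexp_neg_mul_sq (b := 1) (by simp)).bdd_mul (by fun_prop) (.of_forall hexp)
  have hparts := integral_eq_zero_of_hasDerivAt_of_integrable
    (f := fun x : ℝ ↦ cexp (I * s * x) * cexp (-1 * (x : ℂ) ^ 2))
    (f' := fun x : ℝ ↦ I * s * (cexp (I * s * x) * cexp (-1 * (x : ℂ) ^ 2)) -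
      2 * (cexp (I * s * x) * (x * cexp (-1 * (x : ℂ) ^ 2)))) (fun x ↦ by
      have h₁ : HasDerivAt (fun x : ℝ ↦ cexp (I * s * x)) (cexp (I * s * x) * (I * s * 1)) x :=
        ((hasDerivAt_id (x : ℂ)).const_mul (I * s)).cexp.comp_ofReal
      have h₂ : HasDerivAt (fun x : ℝ ↦ cexp (-1 * (x : ℂ) ^ 2))
          (cexp (-1 * (x : ℂ) ^ 2) * (-1 * (2 * x))) x := by
        simpa using (((hasDerivAt_id (x : ℂ)).pow 2).const_mul (-1)).cexp.comp_ofReal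
      exact (h₁.mul h₂).congr_deriv (by ring))
    ((hint₀.const_mul _).sub (hint₁.const_mul _)) hint₀
  rw [integral_sub (hint₀.const_mul _) (hint₁.const_mul _), integral_const_mul,
    integral_const_mul, fourierIntegral_gaussian (by simp)] at hparts
  have hcongr : ∀ x : ℝ, ((gaussianPDFReal 0 1 x * (x * Real.exp (-x ^ 2 / 2)) : ℝ) : ℂ) *
      cexp (s * x * I) =
      ((√(2 * π))⁻¹ : ℝ) * (cexp (I * s * x) * (x * cexp (-1 * (x : ℂ) ^ 2))) := fun x ↦ by
    have h : cexp (-1 * (x : ℂ) ^ 2) = cexp (-x ^ 2 / 2) * cexp (-x ^ 2 / 2) := by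
      rw [← Complex.exp_add]; ring_nf
    rw [h, gaussianPDFReal]
    push_cast
    simp only [mul_one, sub_zero, show (s : ℂ) * x * I = I * s * x by ring]
    ring
  simp_rw [hcongr]
  rw [integral_const_mul]
  simp only [div_one, mul_one] at hparts
  linear_combination (-((√(2 * π))⁻¹ : ℝ) / 2 : ℂ) * hparts

open Complex in
lemma integral_gaussianPDFReal_mul_cexp (s : ℝ) :
    ∫ x : ℝ, (gaussianPDFReal 0 1 x : ℂ) * cexp (s * x * I) = cexp (-s ^ 2 / 2) := by
  have h := charFun_gaussianReal (μ := 0) (v := 1) s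
  rw [charFun_apply_real, integral_gaussianReal_eq_integral_smul one_ne_zero] at h
  simpa [neg_div] using h

lemma psi_eq (k : ℕ) (x : Fin k → ℝ) :
    psi k x = (∏ i, gaussianPDFReal 0 1 (x i)) * (1 + ∏ i, x i * Real.exp (-x i ^ 2 / 2)) := by
  have hc : (2 * π) ^ (-(k : ℝ) / 2) = (√(2 * π))⁻¹ ^ k := by
    rw [Real.sqrt_eq_rpow, ← Real.rpow_neg (by positivity), ← Real.rpow_natCast,
      ← Real.rpow_mul (by positivity)]
    ring_nf
  have he : Real.exp (-(∑ i, x i ^ 2) / 2) = ∏ i, Real.exp (-x i ^ 2 / 2) := by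
    rw [← Real.exp_sum, ← Finset.sum_div, Finset.sum_neg_distrib]
  simp only [psi, hc, he, gaussianPDFReal, Finset.prod_mul_distrib, Finset.prod_const,
    Finset.card_univ, Fintype.card_fin, NNReal.coe_one, mul_one, sub_zero]
  ring

lemma abs_mul_exp_neg_sq_div_two_le_one (x : ℝ) : |x * Real.exp (-x ^ 2 / 2)| ≤ 1 := by
  have h : |x| ≤ Real.exp (x ^ 2 / 2) := by
    have := Real.add_one_le_exp (x ^ 2 / 2)
    nlinarith [sq_nonneg (|x| - 1), sq_abs x]
  rw [abs_mul, Real.abs_exp, neg_div, Real.exp_neg]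
  exact mul_inv_le_one_of_le₀ h (by positivity)

lemma psi_nonneg (k : ℕ) (x : Fin k → ℝ) : 0 ≤ psi k x := by
  rw [psi_eq]
  refine mul_nonneg (Finset.prod_nonneg fun i _ ↦ gaussianPDFReal_nonneg _ _ _) ?_
  have : |∏ i, x i * Real.exp (-x i ^ 2 / 2)| ≤ 1 := by
    rw [Finset.abs_prod]
    exact Finset.prod_le_one (fun _ _ ↦ abs_nonneg _)
      fun i _ ↦ abs_mul_exp_neg_sq_div_two_le_one (x i)
  linarith [neg_abs_le (∏ i, x i * Real.exp (-x i ^ 2 / 2))]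

lemma measurable_psi (k : ℕ) : Measurable (psi k) := by
  unfold psi
  fun_prop

open Complex in
/-- The characteristic function of the sum of the coordinates under `nu k`. -/
lemma exists_charFun_map_sum_nu (k : ℕ) :
    ∃ C : ℂ, C ≠ 0 ∧ ∀ s : ℝ, charFun ((nu k).map fun x ↦ ∑ i, x i) s =
      cexp (-s ^ 2 / 2) ^ k + (C * s * cexp (-s ^ 2 / 4)) ^ k := by
  obtain ⟨C, hC, hCint⟩ := exists_integral_gaussianPDFReal_mul_mul_exp_eq
  refine ⟨C, hC, fun s ↦ ?_⟩
  have hexp : ∀ x : ℝ, ‖cexp (s * x * I)‖ ≤ 1 := fun x ↦ by simp [Complex.norm_exp]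
  have hg : Integrable fun x : ℝ ↦ (gaussianPDFReal 0 1 x : ℂ) * cexp (s * x * I) :=
    (integrable_gaussianPDFReal 0 1).ofReal.mul_bdd (c := 1) (by fun_prop) (.of_forall hexp)
  have hh : Integrable fun x : ℝ ↦
      ((gaussianPDFReal 0 1 x * (x * Real.exp (-x ^ 2 / 2)) : ℝ) : ℂ) * cexp (s * x * I) :=
    (((integrable_gaussianPDFReal 0 1).mul_bdd (c := 1) (by fun_prop)
      (.of_forall abs_mul_exp_neg_sq_div_two_le_one)).ofReal).mul_bdd (c := 1) (by fun_prop)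
      (.of_forall hexp)
  rw [charFun_apply_real, integral_map (by fun_prop) (by fun_prop), nu,
    integral_withDensity_eq_integral_toReal_smul (measurable_psi k).ennreal_ofReal
      (.of_forall fun _ ↦ ENNReal.ofReal_lt_top)]
  have hsplit : ∀ x : Fin k → ℝ,
      (ENNReal.ofReal (psi k x)).toReal • cexp (s * (∑ i, x i : ℝ) * I) =
      (∏ i, (gaussianPDFReal 0 1 (x i) : ℂ) * cexp (s * x i * I)) +
      ∏ i, ((gaussianPDFReal 0 1 (x i) * (x i * Real.exp (-x i ^ 2 / 2)) : ℝ) : ℂ) *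
        cexp (s * x i * I) := fun x ↦ by
    have he : cexp (s * (∑ i, x i : ℝ) * I) = ∏ i, cexp (s * x i * I) := by
      rw [← Complex.exp_sum, ← Finset.sum_mul, ← Finset.mul_sum]
      push_cast
      rfl
    rw [ENNReal.toReal_ofReal (psi_nonneg k x), psi_eq, he, Complex.real_smul]
    simp only [Finset.prod_mul_distrib, Complex.ofReal_mul, Complex.ofReal_add,
      Complex.ofReal_prod, Complex.ofReal_one]
    ring
  simp_rw [hsplit]
  have hgk : Integrable fun x : Fin k → ℝ ↦
      ∏ i, (gaussianPDFReal 0 1 (x i) : ℂ) * cexp (s * x i * I) :=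
    Integrable.fintype_prod fun _ ↦ hg
  have hhk : Integrable fun x : Fin k → ℝ ↦
      ∏ i, ((gaussianPDFReal 0 1 (x i) * (x i * Real.exp (-x i ^ 2 / 2)) : ℝ) : ℂ) *
        cexp (s * x i * I) :=
    Integrable.fintype_prod fun _ ↦ hh
  rw [integral_add hgk hhk,
    integral_fintype_prod_volume_eq_pow
      (fun x : ℝ ↦ (gaussianPDFReal 0 1 x : ℂ) * cexp (s * x * I)),
    integral_fintype_prod_volume_eq_pow (fun x : ℝ ↦
      ((gaussianPDFReal 0 1 x * (x * Real.exp (-x ^ 2 / 2)) : ℝ) : ℂ) * cexp (s * x * I)),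
    integral_gaussianPDFReal_mul_cexp, hCint, Fintype.card_fin]

open Filter in
/-- The modulus of a Gaussian times a fixed Gaussian weight is either bounded or grows faster than
every polynomial, so it cannot stay within `1` of a nonconstant monomial. -/
lemma not_forall_abs_exp_mul_sq_sub_pow_le_one {k : ℕ} (hk : k ≠ 0) {c : ℝ} (hc : 0 < c) (β : ℝ) :
    ¬ ∀ s : ℝ, 1 ≤ s → |Real.exp (β * s ^ 2) - c * s ^ k| ≤ 1 := by
  intro h
  rcases le_or_gt β 0 with hβ | hβ
  · have hs : 1 ≤ 1 + 3 / c := le_add_of_nonneg_right (by positivity)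
    have h₁ := (abs_le.1 (h _ hs)).1
    have h₂ : Real.exp (β * (1 + 3 / c) ^ 2) ≤ 1 :=
      Real.exp_le_one_iff.2 (mul_nonpos_of_nonpos_of_nonneg hβ (sq_nonneg _))
    have h₃ : c * (1 + 3 / c) ≤ c * (1 + 3 / c) ^ k := by
      gcongr
      exact le_self_pow₀ hs hk
    have h₄ : c * (1 + 3 / c) = c + 3 := by field_simp
    linarith
  · have hlit := (isLittleO_pow_exp_pos_mul_atTop k hβ).bound
      (show 0 < 1 / (2 * (1 + c)) by positivity)
    obtain ⟨s, hs, hs₁⟩ := (hlit.and (eventually_ge_atTop (1 : ℝ))).exists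
    have hp : 1 ≤ s ^ k := one_le_pow₀ hs₁
    rw [Real.norm_of_nonneg (by positivity), Real.norm_of_nonneg (by positivity),
      div_mul_eq_mul_div, one_mul, le_div_iff₀ (by positivity)] at hs
    have h₁ := (abs_le.1 (h s hs₁)).2
    have h₂ : Real.exp (β * s) ≤ Real.exp (β * s ^ 2) :=
      Real.exp_le_exp.2 (mul_le_mul_of_nonneg_left (le_self_pow₀ hs₁ two_ne_zero) hβ.le)
    nlinarith

open Complex in
lemma map_sum_nu_ne_gaussianReal {k : ℕ} (hk : k ≠ 0) (a : ℝ) (v : NNReal) :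
    (nu k).map (fun x ↦ ∑ i, x i) ≠ gaussianReal a v := by
  intro h
  obtain ⟨C, hC, hchar⟩ := exists_charFun_map_sum_nu k
  refine not_forall_abs_exp_mul_sq_sub_pow_le_one hk (c := ‖C‖ ^ k) (by positivity)
    (k / 4 - v / 2) fun s hs ↦ ?_
  have hs₀ : 0 ≤ s := by linarith
  have heq := hchar s
  rw [h, charFun_gaussianReal] at heq
  have hmul : cexp (s * a * I + ((k / 4 - v / 2 : ℝ) * s ^ 2 : ℝ)) - (C * s) ^ k =
      cexp ((-(k : ℝ) * s ^ 2 / 4 : ℝ)) := by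
    have h₁ : cexp (s * a * I + ((k / 4 - v / 2 : ℝ) * s ^ 2 : ℝ)) =
        cexp (s * a * I - v * s ^ 2 / 2) * cexp (k * (s ^ 2 / 4)) := by
      rw [← Complex.exp_add]; push_cast; ring_nf
    have h₂ : cexp ((-(k : ℝ) * s ^ 2 / 4 : ℝ)) =
        cexp (-s ^ 2 / 2) ^ k * cexp (k * (s ^ 2 / 4)) := by
      rw [← Complex.exp_nat_mul, ← Complex.exp_add]; push_cast; ring_nf
    have h₃ : cexp (-s ^ 2 / 4) ^ k * cexp (k * (s ^ 2 / 4)) = 1 := by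
      rw [← Complex.exp_nat_mul, ← Complex.exp_add, ← Complex.exp_zero]; ring_nf
    rw [h₁, h₂, heq, mul_pow _ (cexp (-s ^ 2 / 4))]
    linear_combination (C * s) ^ k * h₃
  have hnorm := abs_norm_sub_norm_le
    (cexp (s * a * I + ((k / 4 - v / 2 : ℝ) * s ^ 2 : ℝ))) ((C * s) ^ k)
  have hexp : ‖cexp (s * a * I + ((k / 4 - v / 2 : ℝ) * s ^ 2 : ℝ))‖ =
      Real.exp ((k / 4 - v / 2) * s ^ 2) := by
    rw [Complex.norm_exp, Complex.add_re, Complex.ofReal_re, ← Complex.ofReal_mul,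
      Complex.re_ofReal_mul, Complex.I_re, mul_zero, zero_add]
  have hpow : ‖(C * s) ^ k‖ = ‖C‖ ^ k * s ^ k := by
    rw [norm_pow, norm_mul, Complex.norm_of_nonneg hs₀, mul_pow]
  rw [hmul, hexp, hpow, Complex.norm_exp, Complex.ofReal_re] at hnorm
  refine hnorm.trans (Real.exp_le_one_iff.2 ?_)
  have : 0 ≤ (k : ℝ) * s ^ 2 := by positivity
  linarith

lemma isGaussianMeasure_pi_gaussianReal (k : ℕ) :
    IsGaussianMeasure (Measure.pi fun _ : Fin k ↦ gaussianReal 0 1) := by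
  have hmap : (Measure.pi fun _ : Fin k ↦ gaussianReal 0 1) =
      (stdGaussian (EuclideanSpace ℝ (Fin k))).map (EuclideanSpace.equiv (Fin k) ℝ) := by
    rw [← map_pi_eq_stdGaussian, Measure.map_map (by fun_prop) (by fun_prop)]
    exact Measure.map_id.symm
  have : IsGaussian (Measure.pi fun _ : Fin k ↦ gaussianReal 0 1) := by
    rw [hmap]
    infer_instance
  exact fun L ↦ ⟨_, _, IsGaussian.map_eq_gaussianReal L⟩

/-- `ν` is not the `k`-fold product of standard Gaussians and, moreover,
`ν` is not a Gaussian measure on `ℝ^k`. -/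
theorem nu_not_gaussian (k : ℕ) (hk : 1 < k) :
    nu k ≠ Measure.pi (fun _ : Fin k => gaussianReal 0 1) ∧
      ¬ IsGaussianMeasure (nu k) := by
  have hnot : ¬ IsGaussianMeasure (nu k) := fun h ↦ by
    obtain ⟨a, v, hav⟩ := h (∑ i, ContinuousLinearMap.proj i)
    refine map_sum_nu_ne_gaussianReal (k := k) (by lia) a v ?_
    rw [← hav]
    congr 1
    ext x
    simp
  exact ⟨fun h ↦ hnot (h ▸ isGaussianMeasure_pi_gaussianReal k), hnot⟩
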